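/- (Attainability criterion.) Let p be a prime, r ≥ 1, d = p^{2r}, and let K be an algebraic closure of ℚ_p with its unique absolute value |·| extending the p-adic one (|p| = p⁻¹). Fix a primitive d-th root of unity ζ ∈ K, and let J ∈ K^d with J_i = 1 if p^r ∣ i and 0 otherwise. For ε > 0, say ε is attainable if there exists x ∈ K^d with max_i |x_i − J_i| ≤ ε and max_i |p^{-r} Σ_{j=0}^{d−1} ζ^{ij} x_j| ≤ ε. Then ε is attainable if and only if for every 0 ≤ n ≤ d−1 one has |Ω_{r,n}(ζ)| ≤ max{1, p^r |(ζ;ζ)_n|} · ε, where (ζ;ζ)_n = ∏_{k=1}^{n}(1 − ζ^k). -/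

import Mathlib

/-- The `q`-Pochhammer symbol `(q;q)_n = ∏_{k=1}^n (1 - q^k)` in `ℤ[q]`. -/
noncomputable def qPoch (n : ℕ) : Polynomial ℤ :=
  ∏ i ∈ Finset.range n, (1 - Polynomial.X ^ (i + 1))

/-- An absolute value bounded by `1` on `ℕ` is nonarchimedean. -/
theorem AbsoluteValue.isNonarchimedean_of_forall_natCast_le_one {K : Type*} [Field K]
    (v : AbsoluteValue K ℝ) (h : ∀ n : ℕ, v (n : K) ≤ 1) : IsNonarchimedean v := by
  let := v.toNormedField
  have : IsUltrametricDist K := IsUltrametricDist.isUltrametricDist_of_forall_norm_natCast_le_one h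
  exact fun x y => IsUltrametricDist.norm_add_le_max x y

theorem IsNonarchimedean.absoluteValue_sum_le {K ι : Type*} [Field K] {v : AbsoluteValue K ℝ}
    (hna : IsNonarchimedean v) {c : ℝ} (hc : 0 ≤ c) (s : Finset ι) (f : ι → K)
    (hf : ∀ i ∈ s, v (f i) ≤ c) : v (∑ i ∈ s, f i) ≤ c := by
  induction s using Finset.cons_induction with
  | empty => simpa using hc
  | cons a s ha ih =>
    rw [Finset.sum_cons]
    exact (hna _ _).trans (max_le (hf a (by simp)) (ih fun i hi => hf i (by simp [hi])))

theorem IsNonarchimedean.absoluteValue_mulVec_le {K ι : Type*} [Field K] [Fintype ι]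
    {v : AbsoluteValue K ℝ} (hna : IsNonarchimedean v) {c : ℝ} (hc : 0 ≤ c)
    {A : Matrix ι ι K} (hA : ∀ i j, v (A i j) ≤ 1) {x : ι → K} (hx : ∀ i, v (x i) ≤ c) (i : ι) :
    v (A.mulVec x i) ≤ c := by
  refine hna.absoluteValue_sum_le hc _ _ fun j _ => ?_
  rw [map_mul]
  exact (mul_le_mul (hA i j) (hx j) (v.nonneg _) zero_le_one).trans_eq (one_mul c)

open Matrix in
/-- If `F = L * diagonal w * U` with `L` and `U` invertible over the valuation ring, and `F` fixes
`J`, then `J` is within `ε` of some `x` with `‖F x‖ ≤ ε` iff `L⁻¹ J` is coordinatewise bounded by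
`max 1 |w n| * ε`. -/
theorem exists_approx_iff_of_factorization {K ι : Type*} [Field K] [Fintype ι] [DecidableEq ι]
    {v : AbsoluteValue K ℝ} (hna : IsNonarchimedean v) {ε : ℝ} (hε : 0 < ε)
    {F L L' U U' : Matrix ι ι K} {w J : ι → K}
    (hF : F = L * diagonal w * U) (hFU : F * U' = L * diagonal w) (hLL : L * L' = 1)
    (hL : ∀ i j, v (L i j) ≤ 1) (hL' : ∀ i j, v (L' i j) ≤ 1)
    (hU : ∀ i j, v (U i j) ≤ 1) (hU' : ∀ i j, v (U' i j) ≤ 1) (hJ : F *ᵥ J = J) :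
    (∃ x : ι → K, (∀ i, v (x i - J i) ≤ ε) ∧ ∀ i, v ((F *ᵥ x) i) ≤ ε) ↔
      ∀ n, v ((L' *ᵥ J) n) ≤ max 1 (v (w n)) * ε := by
  constructor
  · rintro ⟨x, hx, hFx⟩ n
    have hLL' : L' * L = 1 := mul_eq_one_comm.mp hLL
    have key : L' *ᵥ J = L' *ᵥ (F *ᵥ x) + diagonal w *ᵥ (U *ᵥ (J - x)) := by
      have h1 : J = F *ᵥ x + F *ᵥ (J - x) := by rw [← mulVec_add, add_sub_cancel, hJ]
      have h2 : L' * F = diagonal w * U := by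
        rw [hF, ← Matrix.mul_assoc, ← Matrix.mul_assoc, hLL', Matrix.one_mul]
      conv_lhs => rw [h1]
      rw [mulVec_add, mulVec_mulVec (J - x) L' F, h2, ← mulVec_mulVec]
    rw [key, Pi.add_apply, mulVec_diagonal, max_mul_of_nonneg _ _ hε.le, one_mul]
    refine (hna _ _).trans (max_le_max (hna.absoluteValue_mulVec_le hε.le hL' hFx n) ?_)
    rw [map_mul]
    refine mul_le_mul_of_nonneg_left (hna.absoluteValue_mulVec_le hε.le hU (fun i => ?_) n)
      (v.nonneg _)
    rw [Pi.sub_apply, v.map_sub]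
    exact hx i
  · intro h
    have hsplit : ∀ n, ∃ u a : K, (L' *ᵥ J) n = u + w n * a ∧ v u ≤ ε ∧ v a ≤ ε := by
      intro n
      rcases le_or_gt (v (w n)) 1 with hw | hw
      · refine ⟨(L' *ᵥ J) n, 0, by simp, ?_, by simpa using hε.le⟩
        simpa [max_eq_left hw] using h n
      · have hw0 : 0 < v (w n) := zero_lt_one.trans hw
        have hwn : w n ≠ 0 := v.pos_iff.mp hw0
        refine ⟨0, (L' *ᵥ J) n / w n, by field_simp; simp, by simpa using hε.le, ?_⟩
        rw [map_div₀, div_le_iff₀ hw0, mul_comm]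
        simpa [max_eq_right hw.le] using h n
    choose u a hua hu ha using hsplit
    have hsum : J = L *ᵥ u + F *ᵥ (U' *ᵥ a) := by
      have h1 : L' *ᵥ J = u + diagonal w *ᵥ a := by
        ext n
        rw [hua, Pi.add_apply, mulVec_diagonal]
      rw [mulVec_mulVec, hFU, ← mulVec_mulVec, ← mulVec_add, ← h1, mulVec_mulVec, hLL, one_mulVec]
    refine ⟨J - U' *ᵥ a, fun i => ?_, fun i => ?_⟩
    · have : (J - U' *ᵥ a) i - J i = -(U' *ᵥ a) i := by simp
      rw [this, v.map_neg]
      exact hna.absoluteValue_mulVec_le hε.le hU' ha i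
    · have : F *ᵥ (J - U' *ᵥ a) = L *ᵥ u := by
        rw [mulVec_sub, hJ]
        nth_rewrite 1 [hsum]
        simp
      rw [this]
      exact hna.absoluteValue_mulVec_le hε.le hL hu i

/-- Coefficients expressing `∏_{k<n} (t - α k)` in the basis `∏_{k<m} (t - β k)`. -/
def newtonCoeff {R : Type*} [CommRing R] (α β : ℕ → R) : ℕ → ℕ → R
  | 0, 0 => 1
  | 0, _ + 1 => 0
  | n + 1, 0 => (β 0 - α n) * newtonCoeff α β n 0
  | n + 1, m + 1 => newtonCoeff α β n m + (β (m + 1) - α n) * newtonCoeff α β n (m + 1)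

theorem newtonCoeff_eq_zero {R : Type*} [CommRing R] (α β : ℕ → R) {n m : ℕ} (h : n < m) :
    newtonCoeff α β n m = 0 := by
  induction n generalizing m with
  | zero =>
    obtain ⟨m, rfl⟩ := Nat.exists_eq_add_of_lt h
    simp [newtonCoeff]
  | succ n ih =>
    obtain _ | m := m
    · omega
    · simp [newtonCoeff, ih (show n < m by omega), ih (show n < m + 1 by omega)]

theorem prod_sub_eq_sum_newtonCoeff {R : Type*} [CommRing R] (α β : ℕ → R) (t : R) {n d : ℕ}
    (h : n < d) :
    ∏ k ∈ Finset.range n, (t - α k) =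
      ∑ m ∈ Finset.range d, newtonCoeff α β n m * ∏ k ∈ Finset.range m, (t - β k) := by
  obtain ⟨d, rfl⟩ : ∃ e, d = e + 1 := ⟨d - 1, by omega⟩
  induction n generalizing d with
  | zero =>
    rw [Finset.sum_range_succ']
    simp [newtonCoeff]
  | succ n ih =>
    have hd := ih (d := d) (by omega)
    have hd' : ∏ k ∈ Finset.range n, (t - α k) =
        ∑ m ∈ Finset.range d, newtonCoeff α β n m * ∏ k ∈ Finset.range m, (t - β k) := by
      obtain ⟨e, rfl⟩ : ∃ e, d = e + 1 := ⟨d - 1, by omega⟩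
      exact ih e (by omega)
    rw [Finset.prod_range_succ, Finset.sum_range_succ']
    have hterm : ∀ m, newtonCoeff α β (n + 1) (m + 1) * ∏ k ∈ Finset.range (m + 1), (t - β k) =
        newtonCoeff α β n m * (∏ k ∈ Finset.range m, (t - β k)) * (t - β m) +
        (β (m + 1) - α n) * (newtonCoeff α β n (m + 1) * ∏ k ∈ Finset.range (m + 1), (t - β k)) := by
      intro m
      rw [newtonCoeff, Finset.prod_range_succ]
      ring
    have hall : ∑ m ∈ Finset.range d, newtonCoeff α β n m * (∏ k ∈ Finset.range m, (t - β k)) *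
          (t - β m) + ∑ m ∈ Finset.range (d + 1), (β m - α n) *
          (newtonCoeff α β n m * ∏ k ∈ Finset.range m, (t - β k)) =
        (∏ k ∈ Finset.range n, (t - α k)) * (t - α n) := by
      rw [Finset.sum_range_succ, newtonCoeff_eq_zero α β (show n < d by omega), hd',
        Finset.sum_mul, zero_mul, mul_zero, add_zero, ← Finset.sum_add_distrib]
      exact Finset.sum_congr rfl fun m _ => by ring
    rw [← hall, Finset.sum_range_succ' (fun m => (β m - α n) * _), Finset.sum_congr rfl
      fun m _ => hterm m, Finset.sum_add_distrib, newtonCoeff]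
    ring

theorem IsNonarchimedean.newtonCoeff_le_one {K : Type*} [Field K] {v : AbsoluteValue K ℝ}
    (hna : IsNonarchimedean v) {α β : ℕ → K} (hα : ∀ n, v (α n) ≤ 1) (hβ : ∀ n, v (β n) ≤ 1)
    (n m : ℕ) : v (newtonCoeff α β n m) ≤ 1 := by
  have hsub : ∀ i j, v (β i - α j) ≤ 1 := fun i j => by
    rw [sub_eq_add_neg]
    exact (hna _ _).trans (max_le (hβ i) (by rw [v.map_neg]; exact hα j))
  have hmul : ∀ {x y : K}, v x ≤ 1 → v y ≤ 1 → v (x * y) ≤ 1 := fun hx hy => by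
    rw [map_mul]
    exact mul_le_one₀ hx (v.nonneg _) hy
  induction n generalizing m with
  | zero => cases m <;> simp [newtonCoeff]
  | succ n ih =>
    cases m with
    | zero => exact hmul (hsub _ _) (ih 0)
    | succ m => exact (hna _ _).trans (max_le (ih m) (hmul (hsub _ _) (ih (m + 1))))

theorem IsNonarchimedean.aeval_int_le_one {K : Type*} [Field K] {v : AbsoluteValue K ℝ}
    (hna : IsNonarchimedean v) {t : K} (ht : v t ≤ 1) (f : Polynomial ℤ) :
    v (Polynomial.aeval t f) ≤ 1 := by
  rw [Polynomial.aeval_eq_sum_range]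
  refine hna.absoluteValue_sum_le zero_le_one _ _ fun i _ => ?_
  rw [zsmul_eq_mul, map_mul, map_pow]
  exact mul_le_one₀ (hna.apply_intCast_le_one) (pow_nonneg (v.nonneg _) _)
    (pow_le_one₀ (v.nonneg _) ht)

theorem qPoch_succ (n : ℕ) : qPoch (n + 1) = qPoch n * (1 - Polynomial.X ^ (n + 1)) := by
  rw [qPoch, Finset.prod_range_succ, qPoch]

theorem qPoch_ne_zero (n : ℕ) : qPoch n ≠ 0 := by
  refine Finset.prod_ne_zero_iff.mpr fun i _ h => ?_
  have := congrArg (Polynomial.eval 0) h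
  simp at this

theorem aeval_qPoch {K : Type*} [Field K] (t : K) (n : ℕ) :
    Polynomial.aeval t (qPoch n) = ∏ k ∈ Finset.range n, (1 - t ^ (k + 1)) := by
  simp [qPoch, map_prod]

section GaussianBinomial

variable {B : ℕ → ℕ → Polynomial ℤ}

theorem gaussBinom_zero_right
    (hB1 : ∀ n k : ℕ, k ≤ n → B n k * (qPoch k * qPoch (n - k)) = qPoch n) (n : ℕ) :
    B n 0 = 1 := by
  have h := hB1 n 0 n.zero_le
  refine mul_right_cancel₀ (qPoch_ne_zero n) ?_
  simpa [qPoch] using h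

theorem gaussBinom_self
    (hB1 : ∀ n k : ℕ, k ≤ n → B n k * (qPoch k * qPoch (n - k)) = qPoch n) (n : ℕ) :
    B n n = 1 := by
  have h := hB1 n n le_rfl
  refine mul_right_cancel₀ (qPoch_ne_zero n) ?_
  simpa [qPoch] using h

theorem gaussBinom_succ_succ (hB0 : ∀ n k : ℕ, n < k → B n k = 0)
    (hB1 : ∀ n k : ℕ, k ≤ n → B n k * (qPoch k * qPoch (n - k)) = qPoch n) (n k : ℕ) :
    B (n + 1) (k + 1) = B n k + Polynomial.X ^ (k + 1) * B n (k + 1) := by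
  rcases lt_trichotomy n k with h | rfl | h
  · simp [hB0 (n + 1) (k + 1) (by omega), hB0 n k h, hB0 n (k + 1) (by omega)]
  · simp [gaussBinom_self hB1, hB0 n (n + 1)]
  · obtain ⟨e, rfl⟩ : ∃ e, n = k + 1 + e := ⟨n - (k + 1), by omega⟩
    have h1 := hB1 (k + 1 + e + 1) (k + 1) (by omega)
    have h2 := hB1 (k + 1 + e) k (by omega)
    have h3 := hB1 (k + 1 + e) (k + 1) (by omega)
    rw [show k + 1 + e + 1 - (k + 1) = e + 1 by omega] at h1
    rw [show k + 1 + e - k = e + 1 by omega] at h2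
    rw [show k + 1 + e - (k + 1) = e by omega] at h3
    rw [qPoch_succ (k + 1 + e)] at h1
    refine mul_right_cancel₀ (mul_ne_zero (qPoch_ne_zero (k + 1)) (qPoch_ne_zero (e + 1))) ?_
    rw [h1, add_mul]
    have e1 : B (k + 1 + e) k * (qPoch (k + 1) * qPoch (e + 1)) =
        qPoch (k + 1 + e) * (1 - Polynomial.X ^ (k + 1)) := by
      rw [← h2, qPoch_succ k]; ring
    have e2 : Polynomial.X ^ (k + 1) * B (k + 1 + e) (k + 1) * (qPoch (k + 1) * qPoch (e + 1)) =
        qPoch (k + 1 + e) * (Polynomial.X ^ (k + 1) * (1 - Polynomial.X ^ (e + 1))) := by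
      rw [← h3, qPoch_succ e]; ring
    rw [e1, e2]
    ring

theorem gaussBinom_mul (hB0 : ∀ n k : ℕ, n < k → B n k = 0)
    (hB1 : ∀ n k : ℕ, k ≤ n → B n k * (qPoch k * qPoch (n - k)) = qPoch n) (k a m : ℕ) :
    B (k + a) (k + m) * B (k + m) k = B (k + a) k * B a m := by
  rcases lt_or_ge a m with h | h
  · simp [hB0 a m h, hB0 (k + a) (k + m) (by omega)]
  · obtain ⟨e, rfl⟩ := Nat.exists_eq_add_of_le h
    have h1 := hB1 (k + (m + e)) (k + m) (by omega)
    have h2 := hB1 (k + m) k (by omega)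
    have h3 := hB1 (k + (m + e)) k (by omega)
    have h4 := hB1 (m + e) m (by omega)
    rw [show k + (m + e) - (k + m) = e by omega] at h1
    rw [show k + m - k = m by omega] at h2
    rw [show k + (m + e) - k = m + e by omega] at h3
    rw [show m + e - m = e by omega] at h4
    refine mul_right_cancel₀ (mul_ne_zero (qPoch_ne_zero k) (mul_ne_zero (qPoch_ne_zero m)
      (qPoch_ne_zero e))) ?_
    calc _ = B (k + (m + e)) (k + m) * (B (k + m) k * (qPoch k * qPoch m) * qPoch e) := by ring
      _ = B (k + (m + e)) k * (qPoch k * (B (m + e) m * (qPoch m * qPoch e))) := by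
        rw [h2, h1, h4, h3]
      _ = _ := by ring

theorem sum_neg_one_pow_mul_gaussBinom (hB0 : ∀ n k : ℕ, n < k → B n k = 0)
    (hB1 : ∀ n k : ℕ, k ≤ n → B n k * (qPoch k * qPoch (n - k)) = qPoch n) (n : ℕ) :
    ∑ m ∈ Finset.range (n + 2), (-1) ^ m * Polynomial.X ^ (m.choose 2) * B (n + 1) m = 0 := by
  have hstep : ∀ c, ∑ m ∈ Finset.range (c + 1), (-1) ^ m * Polynomial.X ^ (m.choose 2) *
      B (n + 1) m = (-1) ^ c * Polynomial.X ^ ((c + 1).choose 2) * B n c := by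
    intro c
    induction c with
    | zero => simp [gaussBinom_zero_right hB1]
    | succ c ih =>
      rw [Finset.sum_range_succ, ih, gaussBinom_succ_succ hB0 hB1,
        Nat.choose_succ_succ' (c + 1) 1, Nat.choose_one_right]
      ring
  rw [hstep, hB0 n (n + 1) (by omega), mul_zero]

/-- Inversion of the lower triangular array of Gaussian binomials. -/
theorem sum_gaussBinom_mul_inverse (hB0 : ∀ n k : ℕ, n < k → B n k = 0)
    (hB1 : ∀ n k : ℕ, k ≤ n → B n k * (qPoch k * qPoch (n - k)) = qPoch n) {i d : ℕ} (k : ℕ)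
    (hi : i < d) :
    ∑ n ∈ Finset.range d, B i n * ((-1) ^ (n - k) * Polynomial.X ^ ((n - k).choose 2) * B n k) =
      if i = k then 1 else 0 := by
  rcases lt_or_ge i k with h | h
  · rw [if_neg h.ne]
    refine Finset.sum_eq_zero fun n _ => ?_
    rcases lt_or_ge i n with hn | hn
    · simp [hB0 i n hn]
    · simp [hB0 n k (by omega)]
  · obtain ⟨a, rfl⟩ := Nat.exists_eq_add_of_le h
    obtain ⟨c, rfl⟩ : ∃ c, d = k + (a + 1) + c := ⟨d - (k + (a + 1)), by omega⟩
    rw [Finset.sum_range_add, Finset.sum_range_add, Finset.sum_eq_zero (s := Finset.range k),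
      Finset.sum_eq_zero (s := Finset.range c), zero_add, add_zero]
    · have hterm : ∀ m, B (k + a) (k + m) * ((-1) ^ (k + m - k) *
          Polynomial.X ^ ((k + m - k).choose 2) * B (k + m) k) =
          B (k + a) k * ((-1) ^ m * Polynomial.X ^ (m.choose 2) * B a m) := by
        intro m
        rw [Nat.add_sub_cancel_left]
        linear_combination ((-1) ^ m * Polynomial.X ^ (m.choose 2)) * gaussBinom_mul hB0 hB1 k a m
      rw [Finset.sum_congr rfl fun m _ => hterm m, ← Finset.mul_sum]
      cases a with
      | zero => simp [gaussBinom_self hB1]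
      | succ a => rw [sum_neg_one_pow_mul_gaussBinom hB0 hB1, mul_zero, if_neg (by omega)]
    · intro m _
      rw [hB0 _ _ (by omega), zero_mul]
    · intro m hm
      rw [hB0 m k (by simpa using hm), mul_zero, mul_zero]

end GaussianBinomial

/-- The Newton products `∏_{k<n} (X^i - X^k)` in terms of Gaussian binomials. -/
theorem prod_X_pow_sub_X_pow {B : ℕ → ℕ → Polynomial ℤ} (hB0 : ∀ n k : ℕ, n < k → B n k = 0)
    (hB1 : ∀ n k : ℕ, k ≤ n → B n k * (qPoch k * qPoch (n - k)) = qPoch n) (i n : ℕ) :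
    ∏ k ∈ Finset.range n, ((Polynomial.X : Polynomial ℤ) ^ i - Polynomial.X ^ k) =
      B i n * ((-1) ^ n * Polynomial.X ^ (n.choose 2) * qPoch n) := by
  rcases lt_or_ge i n with h | h
  · rw [hB0 i n h, zero_mul, Finset.prod_eq_zero (Finset.mem_range.mpr h) (sub_self _)]
  · have key : ∀ n ≤ i, (∏ k ∈ Finset.range n, ((Polynomial.X : Polynomial ℤ) ^ i -
        Polynomial.X ^ k)) * qPoch (i - n) = (-1) ^ n * Polynomial.X ^ (n.choose 2) * qPoch i := by
      intro n hn
      induction n with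
      | zero => simp
      | succ n ih =>
        obtain ⟨e, rfl⟩ := Nat.exists_eq_add_of_le hn
        have ih := ih (by omega)
        rw [show n + 1 + e - n = e + 1 by omega, qPoch_succ] at ih
        rw [Finset.prod_range_succ, show n + 1 + e - (n + 1) = e by omega,
          Nat.choose_succ_succ' n 1, Nat.choose_one_right]
        linear_combination (-(Polynomial.X : Polynomial ℤ) ^ n) * ih
    refine mul_right_cancel₀ (qPoch_ne_zero (i - n)) ?_
    rw [key n h, ← hB1 i n h]
    ring

theorem Fin.sum_mul_dvd_indicator {R : Type*} [CommRing R] {q : ℕ} (hq : 0 < q) {d c : ℕ}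
    (f : ℕ → R) (hc : ∀ k < c, k * q < d) (hf : ∀ k, c ≤ k → k * q < d → f (k * q) = 0) :
    ∑ m : Fin d, f m * (if q ∣ (m : ℕ) then 1 else 0) = ∑ k ∈ Finset.range c, f (k * q) := by
  rw [Fin.sum_univ_eq_sum_range (fun m => f m * (if q ∣ m then 1 else 0))]
  rw [← Finset.sum_image (s := Finset.range c) (g := fun k => k * q) (f := f)
    fun a _ b _ h => Nat.eq_of_mul_eq_mul_right hq h]
  have hsub : (Finset.range c).image (fun k => k * q) ⊆ Finset.range d := by
    intro m hm
    obtain ⟨k, hk, rfl⟩ := Finset.mem_image.mp hm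
    exact Finset.mem_range.mpr (hc k (Finset.mem_range.mp hk))
  rw [← Finset.sum_subset hsub]
  · refine Finset.sum_congr rfl fun m hm => ?_
    obtain ⟨k, -, rfl⟩ := Finset.mem_image.mp hm
    simp
  · intro m hm hm'
    split_ifs with h
    · obtain ⟨k, rfl⟩ := h
      rw [mul_comm q k] at hm hm' ⊢
      rw [hf k ?_ (Finset.mem_range.mp hm), zero_mul]
      by_contra! hk
      exact hm' (Finset.mem_image.mpr ⟨k, Finset.mem_range.mpr hk, rfl⟩)
    · rw [mul_zero]

/-- The normalized Fourier matrix of size `q²` fixes the indicator of the multiples of `q`. -/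
theorem fourier_mulVec_dvd_indicator {K : Type*} [Field K] {q d : ℕ} (hq : 0 < q)
    (hd : d = q * q) (hqK : (q : K) ≠ 0) {ζ : K} (hζ : IsPrimitiveRoot ζ d) (i : ℕ) :
    (q : K)⁻¹ * ∑ j : Fin d, ζ ^ (i * (j : ℕ)) * (if q ∣ (j : ℕ) then 1 else 0) =
      if q ∣ i then 1 else 0 := by
  rw [Fin.sum_mul_dvd_indicator hq (c := q) (fun j => ζ ^ (i * j))
    (fun k hk => by rw [hd]; exact Nat.mul_lt_mul_of_pos_right hk hq)
    (fun k hk hk' => absurd (Nat.lt_of_mul_lt_mul_right (hd ▸ hk')) (by omega))]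
  have hpow : ∀ k, ζ ^ (i * (k * q)) = (ζ ^ (i * q)) ^ k := fun k => by
    rw [← pow_mul]; congr 1; ring
  simp only [hpow]
  have hiff : ζ ^ (i * q) = 1 ↔ q ∣ i := by
    rw [hζ.pow_eq_one_iff_dvd, hd, Nat.mul_dvd_mul_iff_right hq]
  split_ifs with h
  · simp [hiff.mpr h, hqK]
  · have h0 : ζ ^ (i * q) - 1 ≠ 0 := sub_ne_zero.mpr fun h' => h (hiff.mp h')
    have h1 := geom_sum_mul (ζ ^ (i * q)) q
    rw [← pow_mul ζ (i * q) q, mul_assoc, ← hd, mul_comm i d, pow_mul ζ d i,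
      hζ.pow_eq_one, one_pow, sub_self] at h1
    rw [(mul_eq_zero.mp h1).resolve_right h0, mul_zero]

/-- Rewriting a column of the inverse Gaussian binomial array through
`(n-m choose 2) = (n choose 2) + (m+1 choose 2) - n m`. -/
theorem neg_one_pow_mul_pow_choose_sub {K : Type*} [Field K] {t : K} (ht : t ≠ 0) {n m : ℕ}
    (h : m ≤ n) :
    (-1) ^ (n - m) * t ^ ((n - m).choose 2) =
      ((-1) ^ n * t ^ (n.choose 2)) *
        ((-1) ^ m * t ^ (((m + 1).choose 2 : ℤ) - (n * m : ℤ))) := by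
  obtain ⟨e, rfl⟩ := Nat.exists_eq_add_of_le h
  have hchoose : ((e.choose 2 : ℕ) : ℤ) =
      ((m + e).choose 2 : ℤ) + (((m + 1).choose 2 : ℤ) - ((m + e : ℕ) * m : ℤ)) := by
    have h2 : ∀ a : ℕ, 2 * (a.choose 2 : ℤ) = a * (a - 1) := fun a => by
      induction a with
      | zero => simp
      | succ a ih =>
        rw [Nat.choose_succ_succ' a 1, Nat.choose_one_right]
        push_cast
        linarith
    have a1 := h2 e
    have a2 := h2 (m + e)
    have a3 := h2 (m + 1)
    push_cast at *
    linarith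
  rw [Nat.add_sub_cancel_left, ← zpow_natCast t (e.choose 2), hchoose, zpow_add₀ ht,
    zpow_natCast, pow_add (-1 : K) m e]
  have hs : ((-1 : K) ^ m) * (-1) ^ m = 1 := by rw [← mul_pow]; simp
  linear_combination (-((-1) ^ e * t ^ ((m + e).choose 2) *
    t ^ (((m + 1).choose 2 : ℤ) - ((m + e : ℕ) * m : ℤ)))) * hs

/-- The factorization of the scaled Vandermonde matrix through the Newton basis, turned into a
criterion for approximating a fixed vector. -/
theorem exists_approx_iff_gaussBinom {K : Type*} [Field K] {v : AbsoluteValue K ℝ}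
    (hna : IsNonarchimedean v) {ε : ℝ} (hε : 0 < ε) {B : ℕ → ℕ → Polynomial ℤ}
    (hB0 : ∀ n k : ℕ, n < k → B n k = 0)
    (hB1 : ∀ n k : ℕ, k ≤ n → B n k * (qPoch k * qPoch (n - k)) = qPoch n)
    {t : K} (ht : v t = 1) (c : K) {d : ℕ} (J : Fin d → K)
    (hJ : ∀ i : Fin d, c * ∑ j : Fin d, t ^ ((i : ℕ) * (j : ℕ)) * J j = J i) :
    (∃ x : Fin d → K, (∀ i, v (x i - J i) ≤ ε) ∧
        ∀ i : Fin d, v (c * ∑ j : Fin d, t ^ ((i : ℕ) * (j : ℕ)) * x j) ≤ ε) ↔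
      ∀ n : Fin d, v (∑ m : Fin d, (-1) ^ ((n : ℕ) - m) * t ^ (((n : ℕ) - m).choose 2) *
          Polynomial.aeval t (B n m) * J m) ≤
        max 1 (v c * v (∏ k ∈ Finset.range n, (1 - t ^ (k + 1)))) * ε := by
  let F : Matrix (Fin d) (Fin d) K := fun i j => c * t ^ ((i : ℕ) * (j : ℕ))
  let L : Matrix (Fin d) (Fin d) K := fun i n => Polynomial.aeval t (B i n)
  let L' : Matrix (Fin d) (Fin d) K := fun n m =>
    (-1) ^ ((n : ℕ) - m) * t ^ (((n : ℕ) - m).choose 2) * Polynomial.aeval t (B n m)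
  let U : Matrix (Fin d) (Fin d) K := fun n j => newtonCoeff (fun _ => 0) (fun k => t ^ k) j n
  let U' : Matrix (Fin d) (Fin d) K := fun j n => newtonCoeff (fun k => t ^ k) (fun _ => 0) n j
  let w : Fin d → K := fun n =>
    c * ((-1) ^ (n : ℕ) * t ^ ((n : ℕ).choose 2) * ∏ k ∈ Finset.range n, (1 - t ^ (k + 1)))
  have hFx : ∀ (x : Fin d → K) (i : Fin d),
      F.mulVec x i = c * ∑ j : Fin d, t ^ ((i : ℕ) * (j : ℕ)) * x j := fun x i => by
    simp only [F, Matrix.mulVec, dotProduct, Finset.mul_sum, mul_assoc]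
  have hw : ∀ n, v (w n) = v c * v (∏ k ∈ Finset.range n, (1 - t ^ (k + 1))) := fun n => by
    simp only [w, map_mul, map_pow, v.map_neg, map_one, ht, one_pow, one_mul]
  have hB : ∀ i n, v (Polynomial.aeval t (B i n)) ≤ 1 := fun i n =>
    hna.aeval_int_le_one ht.le (B i n)
  have hnewton : ∀ i n : ℕ, ∏ k ∈ Finset.range n, (t ^ i - t ^ k) = Polynomial.aeval t (B i n) *
      ((-1) ^ n * t ^ (n.choose 2) * ∏ k ∈ Finset.range n, (1 - t ^ (k + 1))) := fun i n => by
    have := congrArg (Polynomial.aeval t) (prod_X_pow_sub_X_pow hB0 hB1 i n)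
    simpa [map_prod, aeval_qPoch] using this
  have hpow : ∀ n, v (t ^ n) ≤ 1 := fun n => by rw [map_pow, ht, one_pow]
  have hF : F = L * Matrix.diagonal w * U := by
    ext i j
    rw [Matrix.mul_apply]
    simp_rw [Matrix.mul_diagonal]
    simp only [F, L, U, w]
    have h := prod_sub_eq_sum_newtonCoeff (fun _ => (0 : K)) (fun k => t ^ k) (t ^ (i : ℕ)) j.2
    rw [← Fin.sum_univ_eq_sum_range (fun m => newtonCoeff (fun _ => (0 : K)) (fun k => t ^ k) j m *
      ∏ k ∈ Finset.range m, (t ^ (i : ℕ) - t ^ k))] at h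
    simp only [sub_zero, Finset.prod_const, Finset.card_range, ← pow_mul, hnewton] at h
    rw [h, Finset.mul_sum]
    exact Finset.sum_congr rfl fun n _ => by ring
  have hFU : F * U' = L * Matrix.diagonal w := by
    ext i n
    rw [Matrix.mul_apply, Matrix.mul_diagonal]
    simp only [F, L, U', w]
    have h := prod_sub_eq_sum_newtonCoeff (fun k => t ^ k) (fun _ => (0 : K)) (t ^ (i : ℕ)) n.2
    rw [← Fin.sum_univ_eq_sum_range (fun m => newtonCoeff (fun k => t ^ k) (fun _ => (0 : K)) n m *
      ∏ k ∈ Finset.range m, (t ^ (i : ℕ) - 0))] at h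
    simp only [sub_zero, Finset.prod_const, Finset.card_range, ← pow_mul, hnewton] at h
    rw [mul_left_comm, h, Finset.mul_sum]
    exact Finset.sum_congr rfl fun n _ => by ring
  have hLL : L * L' = 1 := by
    ext i k
    rw [Matrix.mul_apply, Matrix.one_apply]
    have h := congrArg (Polynomial.aeval t) (sum_gaussBinom_mul_inverse hB0 hB1 k i.2)
    rw [← Fin.sum_univ_eq_sum_range (fun n => B i n * ((-1) ^ (n - (k : ℕ)) *
      Polynomial.X ^ ((n - (k : ℕ)).choose 2) * B n k))] at h
    rw [apply_ite (Polynomial.aeval t), map_one, map_zero, map_sum] at h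
    simpa only [map_mul, map_pow, map_neg, map_one, Polynomial.aeval_X, ← Fin.ext_iff] using h
  have key := exists_approx_iff_of_factorization hna hε hF hFU hLL (J := J)
    (fun i j => hB i j)
    (fun i j => by
      simp only [L', map_mul, map_pow, v.map_neg, map_one, ht, one_pow, one_mul]
      exact hB i j)
    (fun i j => hna.newtonCoeff_le_one (fun _ => by simp) hpow _ _)
    (fun i j => hna.newtonCoeff_le_one hpow (fun _ => by simp) _ _)
    (funext fun i => (hFx J i).trans (hJ i))
  simp only [hFx, hw] at key
  exact key

/-- **Attainability criterion** (Ophir–de Shalit, Lemma 7).  `K` is an algebraic closure of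
`ℚ_p` with its unique absolute value `v` extending the `p`-adic one, `d = p^{2r}`, `ζ ∈ K` a
primitive `d`-th root of unity, and `J_i = 1` iff `p^r ∣ i`.  Then `ε` is attainable — i.e.
there is `x ∈ K^d` with `‖x − J‖_sup ≤ ε` and `‖p^{-r} Z x‖_sup ≤ ε` for `Z = (ζ^{ij})` — iff
for all `0 ≤ n ≤ d−1`, `|Ω_{r,n}(ζ)| ≤ max{1, p^r |(ζ;ζ)_n|}·ε`, where
`Ω_{r,n}(ζ) = Σ_{k=0}^{⌊n/p^r⌋} (−1)^{k p^r} ζ^{(kp^r)(kp^r+1)/2 − n k p^r} [n choose kp^r]_ζ`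
and `(ζ;ζ)_n = ∏_{k=1}^n (1 − ζ^k)`.  Here `B` is the Gaussian binomial coefficient
`[n choose k]_q ∈ ℤ[q]`, characterized by `[n choose k]_q (q;q)_k (q;q)_{n−k} = (q;q)_n` for
`k ≤ n` and `[n choose k]_q = 0` for `k > n`. -/
theorem stmt_9 (p : ℕ) [Fact p.Prime] (r : ℕ) (hr : 1 ≤ r)
    (K : Type*) [Field K] [Algebra ℚ_[p] K] [IsAlgClosure ℚ_[p] K]
    (v : AbsoluteValue K ℝ)
    (hv : ∀ x : ℚ_[p], v (algebraMap ℚ_[p] K x) = ‖x‖)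
    (ζ : K) (hζ : IsPrimitiveRoot ζ (p ^ (2 * r)))
    (B : ℕ → ℕ → Polynomial ℤ)
    (hB0 : ∀ n k : ℕ, n < k → B n k = 0)
    (hB1 : ∀ n k : ℕ, k ≤ n → B n k * (qPoch k * qPoch (n - k)) = qPoch n)
    (ε : ℝ) (hε : 0 < ε) :
    (∃ x : Fin (p ^ (2 * r)) → K,
        (∀ i : Fin (p ^ (2 * r)),
            v (x i - (if p ^ r ∣ (i : ℕ) then 1 else 0)) ≤ ε) ∧
        (∀ i : Fin (p ^ (2 * r)),
            v ((p : K) ^ (-(r : ℤ)) *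
                ∑ j : Fin (p ^ (2 * r)), ζ ^ ((i : ℕ) * (j : ℕ)) * x j) ≤ ε))
    ↔ (∀ n : ℕ, n ≤ p ^ (2 * r) - 1 →
        v (∑ k ∈ Finset.range (n / p ^ r + 1),
              (-1) ^ (k * p ^ r) *
                ζ ^ (((k * p ^ r + 1).choose 2 : ℤ) - (n * k * p ^ r : ℤ)) *
                Polynomial.aeval ζ (B n (k * p ^ r)))
          ≤ max 1 ((p : ℝ) ^ r * v (∏ k ∈ Finset.range n, (1 - ζ ^ (k + 1)))) * ε) := by
  have hp : 0 < p := (Fact.out : p.Prime).pos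
  have hq : 0 < p ^ r := pow_pos hp r
  have hd : p ^ (2 * r) = p ^ r * p ^ r := by rw [two_mul, pow_add]
  have hd0 : 0 < p ^ (2 * r) := pow_pos hp _
  have hna : IsNonarchimedean v := v.isNonarchimedean_of_forall_natCast_le_one fun n => by
    rw [← map_natCast (algebraMap ℚ_[p] K), hv]
    exact_mod_cast Padic.norm_int_le_one (n : ℤ)
  have hvp : v (p : K) = (p : ℝ)⁻¹ := by
    rw [← map_natCast (algebraMap ℚ_[p] K), hv, Padic.norm_p]
  have hpK : (p : K) ≠ 0 := by
    rw [← v.pos_iff, hvp]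
    positivity
  have hvζ : v ζ = 1 := by
    refine (pow_eq_one_iff_of_nonneg (v.nonneg ζ) hd0.ne').mp ?_
    rw [← map_pow, hζ.pow_eq_one, map_one]
  have hζ0 : ζ ≠ 0 := hζ.ne_zero hd0.ne'
  have hc : (p : K) ^ (-(r : ℤ)) = ((p ^ r : ℕ) : K)⁻¹ := by
    rw [zpow_neg, zpow_natCast, Nat.cast_pow]
  have hvc : v ((p : K) ^ (-(r : ℤ))) = (p : ℝ) ^ r := by
    rw [zpow_neg, zpow_natCast, map_inv₀, map_pow, hvp, inv_pow, inv_inv]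
  have key := exists_approx_iff_gaussBinom hna hε hB0 hB1 hvζ ((p : K) ^ (-(r : ℤ)))
    (fun i : Fin (p ^ (2 * r)) => if p ^ r ∣ (i : ℕ) then 1 else 0) fun i => by
      rw [hc]
      exact fourier_mulVec_dvd_indicator hq hd (by exact_mod_cast pow_ne_zero r hpK) hζ i
  have hΩ : ∀ n < p ^ (2 * r), v (∑ m : Fin (p ^ (2 * r)), (-1) ^ (n - m) *
      ζ ^ ((n - m).choose 2) * Polynomial.aeval ζ (B n m) *
        (if p ^ r ∣ (m : ℕ) then 1 else 0)) =
      v (∑ k ∈ Finset.range (n / p ^ r + 1), (-1) ^ (k * p ^ r) *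
        ζ ^ (((k * p ^ r + 1).choose 2 : ℤ) - (n * k * p ^ r : ℤ)) *
          Polynomial.aeval ζ (B n (k * p ^ r))) := by
    intro n hn
    have hle : ∀ k, k < n / p ^ r + 1 ↔ k * p ^ r ≤ n := fun k => by
      rw [Nat.lt_succ_iff, Nat.le_div_iff_mul_le hq]
    rw [Fin.sum_mul_dvd_indicator hq (c := n / p ^ r + 1)
      (fun m => (-1) ^ (n - m) * ζ ^ ((n - m).choose 2) * Polynomial.aeval ζ (B n m))
      (fun k hk => ((hle k).mp hk).trans_lt hn)
      (fun k hk _ => by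
        rw [hB0 n (k * p ^ r) (by by_contra! h; exact absurd ((hle k).mpr h) (by omega)),
          map_zero, mul_zero])]
    have hunit : v ((-1) ^ n * ζ ^ (n.choose 2)) = 1 := by
      simp only [map_mul, map_pow, v.map_neg, map_one, hvζ, one_pow, one_mul]
    conv_rhs => rw [← one_mul (v _), ← hunit, ← map_mul, Finset.mul_sum]
    refine congrArg v (Finset.sum_congr rfl fun k hk => ?_)
    rw [neg_one_pow_mul_pow_choose_sub hζ0 ((hle k).mp (Finset.mem_range.mp hk)),
      show (n * k * p ^ r : ℤ) = n * (k * p ^ r : ℕ) by push_cast; ring]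
    ring
  rw [key, Fin.forall_iff]
  refine forall_congr' fun n => ?_
  rw [Nat.le_sub_one_iff_lt hd0]
  refine forall_congr' fun hn => ?_
  rw [hvc, ← hΩ n hn]
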